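/- arXiv:math/0211374 — 4 statements merged into one kernel-verified Lean document; each statement's English description precedes it below -/
import Mathlib

section
/- Define g_k(x) = (k-1+x)·(k-1)!·f_k(x) − x^k for natural numbers k ≥ 1 and real x ≥ 0. Then g_1(x) = −x e^{−x} for all x ≥ 0, g_k(0) = 0 for every k ≥ 2, and for every k ≥ 1 the derivative satisfies g_{k+1}'(x) = k·g_k(x) for all x ≥ 0. -/
/-- The signed tail of the Taylor series of `e^{-x}`:
`f k x = (-1)^k ∑_{j=k}^∞ (-x)^j / j!`. -/
noncomputable def f (k : ℕ) (x : ℝ) : ℝ :=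
  (-1 : ℝ) ^ k * ∑' j : ℕ, (-x) ^ (k + j) / (Nat.factorial (k + j))

/-- `g k x = (k - 1 + x) (k-1)! f_k(x) - x^k`. -/
noncomputable def g (k : ℕ) (x : ℝ) : ℝ :=
  ((k : ℝ) - 1 + x) * (Nat.factorial (k - 1)) * f k x - x ^ k

theorem f_zero' (x : ℝ) : f 0 x = Real.exp (-x) := by
  simp [f, Real.exp_eq_exp_ℝ, NormedSpace.exp_eq_tsum_div]

theorem f_succ' (k : ℕ) (x : ℝ) : f (k + 1) x = x ^ k / (Nat.factorial k) - f k x := by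
  have hs : Summable (fun j : ℕ => (-x) ^ (k + j) / ((Nat.factorial (k + j) : ℕ) : ℝ)) := by
    have := (summable_nat_add_iff k).2 (Real.summable_pow_div_factorial (-x))
    simpa only [add_comm] using this
  have h1 : ∑' j : ℕ, (-x) ^ (k + j) / ((Nat.factorial (k + j) : ℕ) : ℝ)
      = (-x) ^ k / ((Nat.factorial k : ℕ) : ℝ)
        + ∑' j : ℕ, (-x) ^ (k + 1 + j) / ((Nat.factorial (k + 1 + j) : ℕ) : ℝ) := by
    rw [hs.tsum_eq_zero_add, add_zero]
    congr 1
    refine tsum_congr fun j => ?_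
    rw [show k + (j + 1) = k + 1 + j by omega]
  have h3 : (-1 : ℝ) ^ k * (-x) ^ k = x ^ k := by rw [← mul_pow]; ring
  unfold f
  rw [h1, ← h3]
  ring

theorem f_deriv' (k : ℕ) (x : ℝ) : HasDerivAt (f (k + 1)) (f k x) x := by
  induction k with
  | zero =>
    have e : f (0 + 1) = fun x => 1 - Real.exp (-x) := by
      funext y; rw [f_succ', f_zero']; simp
    rw [e, f_zero']
    have := ((hasDerivAt_neg x).exp).const_sub 1
    simpa using this
  | succ k ih =>
    have e : f (k + 1 + 1) = fun x => x ^ (k + 1) / (Nat.factorial (k + 1)) - f (k + 1) x := by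
      funext y; rw [f_succ']
    rw [e, f_succ']
    have := ((hasDerivAt_pow (k + 1) x).div_const ((Nat.factorial (k + 1) : ℕ) : ℝ)).sub ih
    refine HasDerivAt.congr_deriv this ?_
    have hk : ((Nat.factorial k : ℕ) : ℝ) ≠ 0 := by positivity
    have hk1 : (k : ℝ) + 1 ≠ 0 := by positivity
    rw [Nat.factorial_succ]
    push_cast
    field_simp

theorem stmt_4 :
    (∀ x : ℝ, 0 ≤ x → g 1 x = -x * Real.exp (-x)) ∧
    (∀ k : ℕ, 2 ≤ k → g k 0 = 0) ∧
    (∀ k : ℕ, 1 ≤ k → ∀ x : ℝ, 0 ≤ x →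
      HasDerivAt (g (k + 1)) ((k : ℝ) * g k x) x) := by
  refine ⟨fun x _ => ?_, fun k hk => ?_, fun k hk x _ => ?_⟩
  · have := f_succ' 0 x
    rw [f_zero'] at this
    simp only [zero_add] at this
    simp [g, this]
    ring
  · have : f k 0 = 0 := by
      have h : ∀ j : ℕ, k + j ≠ 0 := fun j => by omega
      simp only [f, neg_zero]
      simp [zero_pow (h _)]
    have hk0 : k ≠ 0 := by omega
    simp [g, this, hk0]
  · obtain ⟨m, rfl⟩ : ∃ m, k = m + 1 := ⟨k - 1, by omega⟩
    have h := ((((hasDerivAt_id x).const_add (((m + 1 + 1 : ℕ) : ℝ) - 1)).mul_const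
      ((Nat.factorial (m + 1) : ℕ) : ℝ)).mul (f_deriv' (m + 1) x)).sub
      (hasDerivAt_pow (m + 1 + 1) x)
    refine HasDerivAt.congr_deriv (f := g (m + 1 + 1)) h ?_
    have hk : ((Nat.factorial m : ℕ) : ℝ) ≠ 0 := by positivity
    have hk1 : (m : ℝ) + 1 ≠ 0 := by positivity
    rw [f_succ' (m + 1)]
    simp only [g, Nat.add_sub_cancel, Nat.factorial_succ, id]
    push_cast
    field_simp
    ring
end

section
/- For every natural number n ≥ 1, the function x ↦ e^x f_n(x) is differentiable on ℝ and its derivative equals e^x · x^{n−1} / (n−1)! for every real x. -/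
theorem f_zero_eq (y : ℝ) : f 0 y = Real.exp (-y) := by
  rw [Real.exp_eq_exp_ℝ, NormedSpace.exp_eq_tsum_div]
  simp [f]

theorem f_succ_eq (n : ℕ) (y : ℝ) : f (n + 1) y = y ^ n / (Nat.factorial n) - f n y := by
  have hs : Summable (fun j : ℕ => (-y) ^ (n + j) / ((Nat.factorial (n + j) : ℕ) : ℝ)) := by
    have h := (summable_nat_add_iff n).2 (Real.summable_pow_div_factorial (-y))
    simpa [add_comm] using h
  have h1 := hs.tsum_eq_zero_add
  have h2 : (fun j : ℕ => (-y) ^ (n + (j + 1)) / ((Nat.factorial (n + (j + 1)) : ℕ) : ℝ)) =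
      fun j : ℕ => (-y) ^ (n + 1 + j) / ((Nat.factorial (n + 1 + j) : ℕ) : ℝ) := by
    funext j
    rw [show n + (j + 1) = n + 1 + j by omega]
  rw [h2, add_zero] at h1
  have h3 : (-1 : ℝ) ^ n * (-y) ^ n = y ^ n := by rw [← mul_pow]; simp
  unfold f
  rw [h1, mul_add, ← mul_div_assoc, h3, pow_succ]
  ring

theorem stmt_aux (n : ℕ) (x : ℝ) :
    HasDerivAt (fun y : ℝ => Real.exp y * f (n + 1) y)
      (Real.exp x * x ^ n / (Nat.factorial n)) x := by
  induction n with
  | zero =>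
    have h : (fun y : ℝ => Real.exp y * f (0 + 1) y) = fun y => Real.exp y - 1 := by
      funext y
      rw [f_succ_eq, f_zero_eq, mul_sub, ← Real.exp_add]
      simp
    rw [h]
    simpa using (Real.hasDerivAt_exp x).sub_const 1
  | succ n ih =>
    have h : (fun y : ℝ => Real.exp y * f (n + 1 + 1) y) =
        fun y => Real.exp y * (y ^ (n + 1) / (Nat.factorial (n + 1))) -
          Real.exp y * f (n + 1) y := by
      funext y
      rw [f_succ_eq (n + 1), mul_sub]
    rw [h]
    have hd := ((Real.hasDerivAt_exp x).fun_mul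
      ((hasDerivAt_pow (n + 1) x).div_const ((Nat.factorial (n + 1) : ℕ) : ℝ))).fun_sub ih
    refine hd.congr_deriv ?_
    have h0 : ((Nat.factorial n : ℕ) : ℝ) ≠ 0 := by positivity
    have h1 : (n : ℝ) + 1 ≠ 0 := by positivity
    rw [Nat.factorial_succ]
    push_cast
    field_simp
    ring

theorem stmt_8 (n : ℕ) (hn : 1 ≤ n) (x : ℝ) :
    HasDerivAt (fun y : ℝ => Real.exp y * f n y)
      (Real.exp x * x ^ (n - 1) / (Nat.factorial (n - 1))) x := by
  obtain ⟨m, rfl⟩ : ∃ m, n = m + 1 := ⟨n - 1, by omega⟩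
  exact stmt_aux m x
end

section
/- For every natural number n ≥ 1 and every real number x > 0, one has l(x) > 0, where l(x) = (n−1)!·f_n(x)·((2−2n)x − x² − n(n−1)) + x^{n+1} + (n−1)·x^n. -/
/-- `l n x = (n-1)! f_n(x) ((2-2n)x - x² - n(n-1)) + x^{n+1} + (n-1) x^n`. -/
noncomputable def l (n : ℕ) (x : ℝ) : ℝ :=
  (Nat.factorial (n - 1)) * f n x *
      ((2 - 2 * (n : ℝ)) * x - x ^ 2 - (n : ℝ) * ((n : ℝ) - 1)) +
    x ^ (n + 1) + ((n : ℝ) - 1) * x ^ n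

theorem f_succ_zero' (k : ℕ) : f (k + 1) 0 = 0 := by
  simp [f]

theorem key' (m : ℕ) (hm : 1 ≤ m) (x : ℝ) (hx : 0 < x) :
    (Nat.factorial m) * f (m + 1) x < x ^ (m + 1) * (x + m) / ((x + m) ^ 2 + m) := by
  have hm' : (0 : ℝ) < m := by exact_mod_cast hm
  let F : ℝ → ℝ := fun y =>
    Real.exp y * (y ^ (m + 1) * (y + m) / ((y + m) ^ 2 + m) - (Nat.factorial m) * f (m + 1) y)
  have hF : ∀ y, HasDerivAt F (Real.exp y * (y ^ m * (2 * y * m) / ((y + m) ^ 2 + m) ^ 2)) y := by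
    intro y
    have hQ : (y + m) ^ 2 + (m : ℝ) ≠ 0 := by positivity
    have ha : HasDerivAt (fun y : ℝ => y + m) 1 y := (hasDerivAt_id y).add_const _
    have h := (Real.hasDerivAt_exp y).mul
      ((((hasDerivAt_pow (m + 1) y).mul ha).div ((ha.pow 2).add_const (m : ℝ)) hQ).sub
        ((f_deriv' m y).const_mul (Nat.factorial m : ℝ)))
    refine h.congr_deriv ?_
    have hf : (Nat.factorial m : ℝ) * f m y = y ^ m - (Nat.factorial m) * f (m + 1) y := by
      rw [f_succ']
      have := Nat.factorial_pos m
      field_simp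
      ring
    rw [hf]
    simp only [Pi.mul_apply, Pi.pow_apply, Pi.sub_apply, Pi.div_apply, Nat.add_sub_cancel]
    push_cast
    field_simp
    ring
  have hmono : StrictMonoOn F (Set.Ici 0) := by
    apply strictMonoOn_of_deriv_pos (convex_Ici 0)
    · exact fun y _ => (hF y).continuousAt.continuousWithinAt
    · intro y hy
      rw [interior_Ici] at hy
      have hy : 0 < y := hy
      rw [(hF y).deriv]
      positivity
  have h := hmono (Set.mem_Ici.2 le_rfl) (Set.mem_Ici.2 hx.le) hx
  have h0 : F 0 = 0 := by simp [F, f_succ_zero']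
  rw [h0] at h
  have := (pos_iff_pos_of_mul_pos h).1 (Real.exp_pos x)
  linarith

theorem stmt_11 (n : ℕ) (hn : 1 ≤ n) (x : ℝ) (hx : 0 < x) : 0 < l n x := by
  obtain ⟨m, rfl⟩ : ∃ m, n = m + 1 := ⟨n - 1, by omega⟩
  rcases Nat.eq_zero_or_pos m with rfl | hm
  · have h : l (0 + 1) x = x ^ 2 * Real.exp (-x) := by
      unfold l
      rw [f_succ', f_zero']
      simp
      ring
    rw [h]
    positivity
  · have h := key' m hm x hx
    have hm' : (0 : ℝ) < m := by exact_mod_cast hm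
    rw [lt_div_iff₀ (by positivity)] at h
    unfold l
    simp only [Nat.add_sub_cancel]
    push_cast
    have e : (Nat.factorial m : ℝ) * f (m + 1) x *
        ((2 - 2 * ((m : ℝ) + 1)) * x - x ^ 2 - ((m : ℝ) + 1) * ((m : ℝ) + 1 - 1)) +
        x ^ (m + 1 + 1) + ((m : ℝ) + 1 - 1) * x ^ (m + 1) =
        x ^ (m + 1) * (x + m) - (Nat.factorial m : ℝ) * f (m + 1) x * ((x + m) ^ 2 + m) := by
      ring
    rw [e]
    linarith
end

section
/- Let n ≥ 1 be a natural number, λ a nonzero real number, and c a real number. Define F(y) = (1/(λ^{n+1}·y^{n−1}))·(λ^n·y^n + ∑_{j=0}^{n−1} (−1)^{n−j}·(n!/j!)·(1−λ)·(λy)^j + c·e^{−λy}) for y > 0. Then for every y > 0, the function y ↦ y^{n−1}·e^{λy}·F(y) is differentiable with derivative (n + y)·y^{n−1}·e^{λy}; equivalently, F'(y) + ((n−1)/y + λ)·F(y) = n + y for all y > 0. -/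
open Finset

/-- Cao's first integral for the rotationally symmetric expanding
Kähler–Ricci soliton ODE on `ℂ^n`. -/
noncomputable def F (n : ℕ) (lam c : ℝ) (y : ℝ) : ℝ :=
  (1 / (lam ^ (n + 1) * y ^ (n - 1))) *
    (lam ^ n * y ^ n +
      ∑ j ∈ Finset.range n,
        (-1 : ℝ) ^ (n - j) * ((Nat.factorial n : ℝ) / (Nat.factorial j)) *
          (1 - lam) * (lam * y) ^ j +
      c * Real.exp (-(lam * y)))

lemma P_succ (n : ℕ) (x : ℝ) :
    ∑ j ∈ Finset.range (n+1), (-1 : ℝ) ^ (n + 1 - j) * ((Nat.factorial (n+1) : ℝ) / (Nat.factorial j)) * x ^ j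
     = -((n:ℝ)+1) * (∑ j ∈ Finset.range n, (-1 : ℝ) ^ (n - j) * ((Nat.factorial n : ℝ) / (Nat.factorial j)) * x ^ j + x ^ n) := by
  have hf : (Nat.factorial n : ℝ) ≠ 0 := by positivity
  rw [Finset.sum_range_succ, mul_add, Finset.mul_sum]
  congr 1
  · apply Finset.sum_congr rfl
    intro j hj
    have : n + 1 - j = (n - j) + 1 := by
      have := Finset.mem_range.1 hj
      omega
    rw [this, Nat.factorial_succ, pow_succ]
    push_cast
    ring
  · rw [Nat.factorial_succ]
    have : n + 1 - n = 1 := by omega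
    rw [this]
    push_cast
    field_simp

lemma P_deriv (n : ℕ) (x : ℝ) :
    HasDerivAt (fun x : ℝ => ∑ j ∈ Finset.range n, (-1 : ℝ) ^ (n - j) * ((Nat.factorial n : ℝ) / (Nat.factorial j)) * x ^ j)
      (-(n:ℝ) * x ^ (n-1) - ∑ j ∈ Finset.range n, (-1 : ℝ) ^ (n - j) * ((Nat.factorial n : ℝ) / (Nat.factorial j)) * x ^ j) x := by
  induction n with
  | zero => simpa using hasDerivAt_const x (0:ℝ)
  | succ n ih =>
    simp only [P_succ]
    refine ((ih.add (hasDerivAt_pow n x)).const_mul (-((n:ℝ)+1))).congr_deriv ?_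
    push_cast
    ring

theorem stmt_16 (n : ℕ) (hn : 1 ≤ n) (lam : ℝ) (hlam : lam ≠ 0) (c : ℝ)
    (y : ℝ) (hy : 0 < y) :
    HasDerivAt (fun z : ℝ => z ^ (n - 1) * Real.exp (lam * z) * F n lam c z)
      (((n : ℝ) + y) * y ^ (n - 1) * Real.exp (lam * y)) y ∧
    deriv (F n lam c) y + (((n : ℝ) - 1) / y + lam) * F n lam c y =
      (n : ℝ) + y := by
  obtain ⟨m, rfl⟩ : ∃ m, n = m + 1 := ⟨n - 1, by omega⟩
  have hl : HasDerivAt (fun z : ℝ => lam * z) lam y := by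
    simpa using (hasDerivAt_id y).const_mul lam
  have hS : ∀ z : ℝ, ∑ j ∈ Finset.range (m+1),
        (-1 : ℝ) ^ (m + 1 - j) * ((Nat.factorial (m+1) : ℝ) / (Nat.factorial j)) *
          (1 - lam) * (lam * z) ^ j = (1 - lam) * ∑ j ∈ Finset.range (m+1),
        (-1 : ℝ) ^ (m + 1 - j) * ((Nat.factorial (m+1) : ℝ) / (Nat.factorial j)) * (lam * z) ^ j := by
    intro z
    rw [Finset.mul_sum]
    exact Finset.sum_congr rfl fun j _ => by ring
  have hP := (P_deriv (m+1) (lam * y)).comp y hl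
  have hF : F (m+1) lam c = fun z => _ := funext fun z => by rw [F, hS z]
  have hex := hl.exp
  simp only [Nat.add_sub_cancel] at *
  have h1 : HasDerivAt (fun z : ℝ => z ^ m * Real.exp (lam * z) * F (m+1) lam c z)
      ((((m + 1 : ℕ) : ℝ) + y) * y ^ m * Real.exp (lam * y)) y := by
    have key := ((hex.mul (((hasDerivAt_pow (m+1) y).const_mul (lam^(m+1))).add
      (hP.const_mul (1 - lam)))).add_const c).const_mul (1 / lam^(m+2))
    refine (key.congr_of_eventuallyEq ?_).congr_deriv ?_
    · filter_upwards [lt_mem_nhds hy] with z hz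
      rw [hF]
      simp only [Function.comp, Pi.add_apply, Pi.mul_apply, Real.exp_neg]
      have := Real.exp_ne_zero (lam * z)
      field_simp
      ring
    · simp only [Function.comp, Pi.add_apply, Pi.mul_apply, Nat.add_sub_cancel]
      push_cast
      field_simp
      ring
  refine ⟨h1, ?_⟩
  have hd : DifferentiableAt ℝ (F (m+1) lam c) y := by
    unfold F
    have : lam ^ (m + 1 + 1) * y ^ (m + 1 - 1) ≠ 0 := by positivity
    fun_prop (disch := assumption)
  have h2 := (((hasDerivAt_pow m y).mul hex).mul hd.hasDerivAt).unique h1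
  have hE := Real.exp_ne_zero (lam * y)
  have hm : (m:ℝ) * y ^ (m-1) = m / y * y ^ m := by
    rcases m with _ | k
    · simp
    · rw [Nat.add_sub_cancel, pow_succ]; field_simp
  simp only [Pi.mul_apply] at h2
  rw [hm] at h2
  have hy' : y ^ m * Real.exp (lam * y) ≠ 0 := by positivity
  apply mul_left_cancel₀ hy'
  push_cast at h2 ⊢
  linear_combination h2
end
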